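/- Let n ≥ 2 and let 𝔤 be the (2n+1)-dimensional real Lie algebra with basis {ξ, X₁, Y₁, …, Xₙ, Yₙ} whose only non-vanishing Lie brackets among basis vectors are [ξ,X₁] = X₁ + Y₁, [ξ,Y₁] = −Y₁, [X₁,Y₁] = 2ξ, and for i = 2,…,n: [Xᵢ,Yᵢ] = 2(ξ + Yᵢ), [X₁,Yᵢ] = X₁ + Y₁, [Y₁,Yᵢ] = −Y₁. Let φ : 𝔤 → 𝔤 be the linear map with φξ = 0, φX₁ = X₁, φY₁ = −Y₁, φXᵢ = −Xᵢ and φYᵢ = Yᵢ for i = 2,…,n, and define h : 𝔤 → 𝔤 by hX = ½([ξ, φX] − φ[ξ, X]). Then h X₁ = Y₁, h Y₁ = 0, h Xᵢ = h Yᵢ = 0 for i = 2,…,n and h ξ = 0; consequently h ∘ h = 0, h ≠ 0 and rank h = 1. -/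

import Mathlib

/-- The paper's Example 4.5: computation of the tensor `h = ½ L_ξ φ` for the
`(2n+1)`-dimensional paracontact metric `(-1,0)`-space with `rank h = 1`.
Indices are 0-based, so `X i₀ = X₁`, `Y i₀ = Y₁`, and `i ≠ i₀` corresponds to
`i ∈ {2,…,n}`. -/
theorem h_tensor_example_mu0_rank_one
    (𝔤 : Type*) [LieRing 𝔤] [LieAlgebra ℝ 𝔤]
    (n : ℕ) (hn : 2 ≤ n)
    (ξ : 𝔤) (X Y : Fin n → 𝔤)
    (i₀ : Fin n) (hi₀ : (i₀ : ℕ) = 0)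
    (b : Module.Basis (Unit ⊕ Fin n ⊕ Fin n) ℝ 𝔤)
    (hbξ : b (Sum.inl ()) = ξ)
    (hbX : ∀ i, b (Sum.inr (Sum.inl i)) = X i)
    (hbY : ∀ i, b (Sum.inr (Sum.inr i)) = Y i)
    -- the only non-vanishing Lie brackets among basis vectors:
    (br1 : ⁅ξ, X i₀⁆ = X i₀ + Y i₀)
    (br2 : ⁅ξ, Y i₀⁆ = -Y i₀)
    (br3 : ∀ i, i ≠ i₀ → ⁅ξ, X i⁆ = 0)
    (br4 : ∀ i, i ≠ i₀ → ⁅ξ, Y i⁆ = 0)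
    (br5 : ⁅X i₀, Y i₀⁆ = (2 : ℝ) • ξ)
    (br6 : ∀ i, i ≠ i₀ → ⁅X i, Y i⁆ = (2 : ℝ) • (ξ + Y i))
    (br7 : ∀ i, i ≠ i₀ → ⁅X i₀, Y i⁆ = X i₀ + Y i₀)
    (br8 : ∀ i, i ≠ i₀ → ⁅Y i₀, Y i⁆ = -Y i₀)
    (br9 : ∀ i j, i ≠ i₀ → i ≠ j → ⁅X i, Y j⁆ = 0)
    (br10 : ∀ i j, ⁅X i, X j⁆ = 0)
    (br11 : ∀ i j, i ≠ i₀ → j ≠ i₀ → ⁅Y i, Y j⁆ = 0)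
    -- the structure tensor φ:
    (φ : 𝔤 →ₗ[ℝ] 𝔤)
    (hφξ : φ ξ = 0)
    (hφX1 : φ (X i₀) = X i₀) (hφY1 : φ (Y i₀) = -Y i₀)
    (hφX : ∀ i, i ≠ i₀ → φ (X i) = -X i)
    (hφY : ∀ i, i ≠ i₀ → φ (Y i) = Y i)
    -- the tensor h = ½ L_ξ φ:
    (h : 𝔤 →ₗ[ℝ] 𝔤)
    (hdef : ∀ x : 𝔤, h x = (1 / 2 : ℝ) • (⁅ξ, φ x⁆ - φ ⁅ξ, x⁆)) :
    h (X i₀) = Y i₀ ∧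
    h (Y i₀) = 0 ∧
    (∀ i, i ≠ i₀ → h (X i) = 0 ∧ h (Y i) = 0) ∧
    h ξ = 0 ∧
    h ∘ₗ h = 0 ∧
    h ≠ 0 ∧
    Module.finrank ℝ (LinearMap.range h) = 1 := by
  have e1 : h (X i₀) = Y i₀ := by
    rw [hdef, hφX1, br1, map_add, hφX1, hφY1]
    module
  have e2 : h (Y i₀) = 0 := by
    rw [hdef, hφY1, lie_neg, br2, map_neg, hφY1]
    module
  have e3 : ∀ i, i ≠ i₀ → h (X i) = 0 ∧ h (Y i) = 0 := by
    intro i hi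
    constructor
    · rw [hdef, hφX i hi, lie_neg, br3 i hi]; simp
    · rw [hdef, hφY i hi, br4 i hi]; simp
  have e4 : h ξ = 0 := by
    rw [hdef, hφξ]; simp
  have hY : Y i₀ ≠ 0 := by
    rw [← hbY]; exact b.ne_zero _
  have hrange : LinearMap.range h = Submodule.span ℝ {Y i₀} := by
    apply le_antisymm
    · rw [LinearMap.range_eq_map, ← b.span_eq, Submodule.map_span, Submodule.span_le]
      rintro _ ⟨_, ⟨k, rfl⟩, rfl⟩
      rcases k with ⟨⟩ | i | i
      · rw [hbξ, e4]; exact Submodule.zero_mem _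
      · rw [hbX]
        by_cases hi : i = i₀
        · rw [hi, e1]; exact Submodule.mem_span_singleton_self _
        · rw [(e3 i hi).1]; exact Submodule.zero_mem _
      · rw [hbY]
        by_cases hi : i = i₀
        · rw [hi, e2]; exact Submodule.zero_mem _
        · rw [(e3 i hi).2]; exact Submodule.zero_mem _
    · rw [Submodule.span_singleton_le_iff_mem]
      exact ⟨_, e1⟩
  refine ⟨e1, e2, e3, e4, ?_, ?_, ?_⟩
  · ext x
    have hx : h x ∈ Submodule.span ℝ {Y i₀} := hrange ▸ LinearMap.mem_range_self h x
    obtain ⟨c, hc⟩ := Submodule.mem_span_singleton.1 hx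
    rw [LinearMap.comp_apply, ← hc, map_smul, e2, smul_zero, LinearMap.zero_apply]
  · intro h0
    apply hY
    rw [← e1, h0, LinearMap.zero_apply]
  · rw [hrange]
    exact finrank_span_singleton hY
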